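/- Let k be a field of characteristic 0, let m ≥ 4, and let φ : Alt_m → GL_n(k) be a faithful irreducible representation (i.e. φ is injective and k^n is a simple k[Alt_m]-module under φ). If m ≠ 5 then n ≥ m − 1; if m = 5 then n ≥ 3. -/

import Mathlib

/-- A representation `φ : H → GL_n(k)` is irreducible: `k^n` is a nonzero module whose only
`H`-invariant submodules are `⊥` and `⊤` (i.e. `k^n` is a simple `k[H]`-module). -/
def IrreducibleRep {k : Type*} [Field k] {H : Type*} [Group H] {n : ℕ}
    (φ : H →* Matrix.GeneralLinearGroup (Fin n) k) : Prop :=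
  (⊥ : Submodule k (Fin n → k)) ≠ ⊤ ∧
    ∀ W : Submodule k (Fin n → k),
      (∀ g : H, ∀ v ∈ W, Matrix.mulVec ((φ g : Matrix (Fin n) (Fin n) k)) v ∈ W) →
      W = ⊥ ∨ W = ⊤

open Equiv Equiv.Perm Module

section LinearAlgebra

variable {k V : Type*} [Field k] [AddCommGroup V] [Module k V]

/-- The relations satisfied by the images of two double transpositions `P`, `Q` and a `3`-cycle `X`
in a representation of the alternating group on four letters. -/
structure IsTetrahedral (P Q X : End k V) : Prop where
  P_sq : ∀ v, P (P v) = v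
  Q_sq : ∀ v, Q (Q v) = v
  comm : ∀ v, P (Q v) = Q (P v)
  X_cube : ∀ v, X (X (X v)) = v
  X_P : ∀ v, X (P v) = Q (X v)
  X_Q : ∀ v, X (Q v) = P (Q (X v))

namespace IsTetrahedral

variable {P Q X : End k V}

theorem exists_weight_vector (h : IsTetrahedral P Q X) {v : V} (hv : P v ≠ v) :
    ∃ t, t ≠ 0 ∧ P t = t ∧ Q t = -t := by
  have hX : ∀ s, X s = 0 → s = 0 := fun s hs => by
    rw [← h.X_cube s, hs, map_zero, map_zero]
  have key : ∀ s, s ≠ 0 → P s = -s → Q s = s ∨ Q s = -s → ∃ t, t ≠ 0 ∧ P t = t ∧ Q t = -t := by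
    have step : ∀ s, s ≠ 0 → P s = -s → Q s = -s → ∃ t, t ≠ 0 ∧ P t = t ∧ Q t = -t := by
      intro s hs hPs hQs
      have h1 : Q (X s) = -X s := by rw [← h.X_P, hPs, map_neg]
      have h2 : P (Q (X s)) = -X s := by rw [← h.X_Q, hQs, map_neg]
      exact ⟨X s, fun h0 => hs (hX s h0), by rw [h1, map_neg] at h2; exact neg_injective h2, h1⟩
    rintro s hs hPs (hQs | hQs)
    · have h1 : Q (X s) = -X s := by rw [← h.X_P, hPs, map_neg]
      have h2 : P (Q (X s)) = X s := by rw [← h.X_Q, hQs]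
      exact step (X s) (fun h0 => hs (hX s h0))
        (by rw [h1, map_neg] at h2; exact neg_eq_iff_eq_neg.mp h2) h1
    · exact step s hs hPs hQs
  by_cases hz : (v - P v) + Q (v - P v) = 0
  · refine key (v - P v) (fun h0 => hv (sub_eq_zero.mp h0).symm) (by simp [h.P_sq]) (Or.inr ?_)
    exact (neg_eq_of_add_eq_zero_right hz).symm
  · refine key _ hz ?_ (Or.inl ?_)
    · rw [map_add, h.comm, map_sub, h.P_sq]
      simp only [map_sub]
      abel
    · rw [map_add, h.Q_sq, add_comm]

variable {t : V}

theorem P_X (h : IsTetrahedral P Q X) (hP : P t = t) (hQ : Q t = -t) : P (X t) = -X t := by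
  have h1 : Q (X t) = X t := by rw [← h.X_P, hP]
  have h2 : P (Q (X t)) = -X t := by rw [← h.X_Q, hQ, map_neg]
  rwa [h1] at h2

theorem Q_X (h : IsTetrahedral P Q X) (hP : P t = t) : Q (X t) = X t := by
  rw [← h.X_P, hP]

theorem Q_X_X (h : IsTetrahedral P Q X) (hP : P t = t) (hQ : Q t = -t) :
    Q (X (X t)) = -X (X t) := by
  rw [← h.X_P, h.P_X hP hQ, map_neg]

theorem P_X_X (h : IsTetrahedral P Q X) (hP : P t = t) (hQ : Q t = -t) :
    P (X (X t)) = -X (X t) := by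
  have h2 : P (Q (X (X t))) = X (X t) := by rw [← h.X_Q, h.Q_X hP]
  rw [h.Q_X_X hP hQ, map_neg] at h2
  rw [← neg_eq_iff_eq_neg, h2]

variable [CharZero k]

theorem three_le_finrank [FiniteDimensional k V] (h : IsTetrahedral P Q X) {v : V}
    (hv : P v ≠ v) : 3 ≤ finrank k V := by
  obtain ⟨t, ht, hP, hQ⟩ := h.exists_weight_vector hv
  have hX : ∀ s, X s = 0 → s = 0 := fun s hs => by
    rw [← h.X_cube s, hs, map_zero, map_zero]
  have hli : LinearIndependent k ![t, X t, X (X t)] := by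
    rw [Fintype.linearIndependent_iff]
    intro g hg
    simp only [Fin.sum_univ_three, Matrix.cons_val_zero, Matrix.cons_val_one,
      Matrix.cons_val] at hg
    have hg1 := congrArg P hg
    have hg2 := congrArg Q hg
    simp only [map_add, map_smul, map_zero, hP, hQ, h.P_X hP hQ, h.Q_X hP, h.P_X_X hP hQ,
      h.Q_X_X hP hQ] at hg1 hg2
    have e0 : g 0 • t = 0 := by
      linear_combination (norm := module) (1/2 : k) • hg + (1/2 : k) • hg1
    have e1 : g 1 • X t = 0 := by
      linear_combination (norm := module) (1/2 : k) • hg + (1/2 : k) • hg2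
    have e2 : g 2 • X (X t) = 0 := by
      linear_combination (norm := module) hg - e0 - e1
    have ht1 : X t ≠ 0 := fun h0 => ht (hX _ h0)
    have ht2 : X (X t) ≠ 0 := fun h0 => ht1 (hX _ h0)
    intro i
    fin_cases i
    · simpa [ht] using e0
    · simpa [ht1] using e1
    · simpa [ht2] using e2
  simpa using hli.fintype_card_le_finrank

theorem exists_fixed_vector (h : IsTetrahedral P Q X) {v : V} (hv : P v ≠ v) :
    ∃ t, t ≠ 0 ∧ X t = t := by
  obtain ⟨t, ht, hP, hQ⟩ := h.exists_weight_vector hv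
  refine ⟨t + X t + X (X t), fun h0 => ht ?_, ?_⟩
  · have h1 := congrArg P h0
    simp only [map_add, map_zero, hP, h.P_X hP hQ, h.P_X_X hP hQ] at h1
    linear_combination (norm := module) (1/2 : k) • h0 + (1/2 : k) • h1
  · simp only [map_add, h.X_cube]
    abel

theorem exists_negated_vector (h : IsTetrahedral P Q X) {v : V} (hv : P v ≠ v) :
    ∃ w, w ≠ 0 ∧ P w = -w ∧ w + X w + X (X w) = 0 := by
  obtain ⟨t, ht, hP, hQ⟩ := h.exists_weight_vector hv
  refine ⟨X t - X (X t), fun h0 => ht ?_, ?_, ?_⟩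
  · have h1 := congrArg Q h0
    simp only [map_sub, map_zero, h.Q_X hP, h.Q_X_X hP hQ] at h1
    have h2 : X t = 0 := by
      linear_combination (norm := module) (1/2 : k) • h0 + (1/2 : k) • h1
    rw [← h.X_cube t, h2, map_zero, map_zero]
  · simp only [map_sub, h.P_X hP hQ, h.P_X_X hP hQ]
    abel
  · simp only [map_sub, h.X_cube]
    abel

end IsTetrahedral

variable [CharZero k]

theorem two_mul_finrank_eigenspace_lt [FiniteDimensional k V] {Y S : End k V} {ω : k}
    (hω : ω ^ 2 + ω + 1 = 0) (hS : Function.Injective S) (hYS : ∀ v, Y (S v) = S (Y (Y v)))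
    {t : V} (ht : t ≠ 0) (hYt : Y t = t) :
    2 * finrank k (Y.eigenspace ω) < finrank k V := by
  let E := Y.eigenspace ω
  let Ψ : (E × E) × k →ₗ[k] V :=
    (E.subtype.coprod (S ∘ₗ E.subtype)).coprod (LinearMap.toSpanSingleton k V t)
  have hΨ : Function.Injective Ψ := by
    rw [injective_iff_map_eq_zero]
    rintro ⟨⟨⟨u, hu⟩, ⟨v, hv⟩⟩, c⟩ h0
    replace h0 : u + S v + c • t = 0 := by simpa [Ψ] using h0
    have hu' : Y u = ω • u := End.mem_eigenspace_iff.mp hu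
    have hv' : Y v = ω • v := End.mem_eigenspace_iff.mp hv
    have h1 := congrArg Y h0
    simp only [map_add, map_smul, map_zero, hYS, hu', hv', hYt] at h1
    have h2 := congrArg Y h1
    simp only [map_add, map_smul, map_zero, hYS, hu', hv', hYt] at h2
    have hne : ω ^ 2 - ω ≠ 0 := fun h => by
      have h3 : (3 : k) = 0 := by linear_combination -(ω ^ 2 - ω) * h + (ω ^ 2 - 3 * ω + 3) * hω
      norm_num at h3
    have ec : c • t = 0 := by
      linear_combination (norm := module) (1/3 : k) • h0 + (1/3 : k) • h1 + (1/3 : k) • h2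
        - hω • ((1/3 : k) • u) - hω • ((1/3 * (1 - ω + ω ^ 2) : k) • S v)
    have eu : (ω ^ 2 - ω) • u = 0 := by
      linear_combination (norm := module) (ω ^ 2) • h0 - h1 - (ω ^ 2 - 1) • ec
    replace eu : u = 0 := (smul_eq_zero.mp eu).resolve_left hne
    have ev : S v = 0 := by
      linear_combination (norm := module) h0 - eu - ec
    have hc : c = 0 := by simpa [ht] using ec
    have hv0 : v = 0 := hS (by rw [ev, map_zero])
    simp [eu, hv0, hc]
  have := LinearMap.finrank_le_finrank_of_injective hΨ
  simp only [finrank_prod, finrank_self, E] at this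
  omega

theorem fixes_of_fixes_eigenspaces {Y D : End k V} {ω : k} (hω : ω ^ 2 + ω + 1 = 0)
    (h1 : ∀ v, Y v = ω • v → D v = v) (h2 : ∀ v, Y v = ω ^ 2 • v → D v = v) {w : V}
    (hw : w + Y w + Y (Y w) = 0) : D w = w := by
  have hω3 : ω ^ 3 = 1 := by linear_combination (ω - 1) * hω
  have e1 := h1 (Y w - ω ^ 2 • w) (by
    rw [map_sub, map_smul]
    linear_combination (norm := module) hw - hω • (Y w) + hω3 • w)
  have e2 := h2 (Y w - ω • w) (by
    rw [map_sub, map_smul]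
    linear_combination (norm := module) hw - hω • (Y w) + hω3 • w)
  have hne : ω - ω ^ 2 ≠ 0 := fun h => by
    have h3 : (3 : k) = 0 := by linear_combination -(ω - ω ^ 2) * h + (ω ^ 2 - 3 * ω + 3) * hω
    norm_num at h3
  have : (ω - ω ^ 2) • D w = (ω - ω ^ 2) • w := by
    rw [map_sub, map_smul] at e1 e2
    linear_combination (norm := module) e1 - e2
  exact smul_right_injective V hne this

end LinearAlgebra

section Permutations

variable {α : Type*} [DecidableEq α]

/-- The `3`-cycle `a ↦ b ↦ c ↦ a`. -/
def cyc (a b c : α) : Perm α := swap a b * swap b c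

/-- The double transposition `(a b)(c d)`. -/
def dbl (a b c d : α) : Perm α := swap a b * swap c d

theorem conj_dbl (σ : Perm α) (a b c d : α) :
    σ * dbl a b c d = dbl (σ a) (σ b) (σ c) (σ d) * σ := by
  simp only [dbl, mul_assoc, swap_apply_apply]
  simp

theorem conj_cyc (σ : Perm α) (a b c : α) :
    σ * cyc a b c = cyc (σ a) (σ b) (σ c) * σ := by
  simp only [cyc, mul_assoc, swap_apply_apply]
  simp

theorem conj_cyc_eq {σ : Perm α} {a b c a' b' c' : α} (ha : σ a = a') (hb : σ b = b')
    (hc : σ c = c') : σ * cyc a b c = cyc a' b' c' * σ := by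
  rw [conj_cyc, ha, hb, hc]

theorem cyc_rotate {a b c : α} (h : [a, b, c].Nodup) : cyc b c a = cyc a b c := by
  ext z
  simp only [cyc, Perm.mul_apply, swap_apply_def]
  grind

variable [Fintype α]

theorem sign_cyc {a b c : α} (h : [a, b, c].Nodup) : sign (cyc a b c) = 1 := by
  simp at h
  simp [cyc, h]

theorem sign_dbl {a b c d : α} (hab : a ≠ b) (hcd : c ≠ d) : sign (dbl a b c d) = 1 := by
  simp [dbl, hab, hcd]

theorem exists_even_map_eq {l l' : List α} (hl : l.Nodup) (hl' : l'.Nodup)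
    (hlen : l.length = l'.length) (hcard : l.length + 2 ≤ Fintype.card α) :
    ∃ g : Perm α, sign g = 1 ∧ l.map g = l' := by
  have := alternatingGroup.isMultiplyPretransitive α
  have : MulAction.IsMultiplyPretransitive (alternatingGroup α) α l.length :=
    MulAction.isMultiplyPretransitive_of_le (n := Nat.card α - 2) (by simp; omega) (by simp)
  obtain ⟨g, hg⟩ := MulAction.exists_smul_eq (alternatingGroup α)
    (⟨l.get, List.nodup_iff_injective_get.mp hl⟩ : Fin l.length ↪ α)
    ⟨fun i => l'.get (i.cast hlen), fun i j hij => by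
      simpa using List.nodup_iff_injective_get.mp hl' hij⟩
  refine ⟨g, mem_alternatingGroup.mp g.2, List.ext_get (by simpa using hlen) fun n h1 h2 => ?_⟩
  simpa [Subgroup.smul_def] using DFunLike.congr_fun hg ⟨n, by simpa using h1⟩

theorem exists_notMem_list {l : List α} (h : l.length < Fintype.card α) : ∃ z, z ∉ l := by
  by_contra! hc
  have h1 : Finset.univ ⊆ l.toFinset := fun z _ => by simpa using hc z
  have h2 := Finset.card_le_card h1
  have := l.toFinset_card_le
  rw [Finset.card_univ] at h2
  omega

end Permutations

section Evaluation

variable {k V α : Type*} [Field k] [AddCommGroup V] [Module k V] [Fintype α] [DecidableEq α]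

/-- The operator by which an even permutation acts, extended by zero to odd permutations. -/
def altEval (ρ : alternatingGroup α →* End k V) (g : Perm α) : End k V :=
  if h : sign g = 1 then ρ ⟨g, mem_alternatingGroup.mpr h⟩ else 0

variable (ρ : alternatingGroup α →* End k V)

theorem altEval_coe (g : alternatingGroup α) : altEval ρ g = ρ g := by
  simp [altEval, mem_alternatingGroup.mp g.2]

theorem altEval_one (v : V) : altEval ρ 1 v = v := by
  rw [← Subgroup.coe_one, altEval_coe, map_one, Module.End.one_apply]

theorem altEval_mul {g h : Perm α} (hg : sign g = 1) (hh : sign h = 1) (v : V) :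
    altEval ρ (g * h) v = altEval ρ g (altEval ρ h v) := by
  have hgh : sign (g * h) = 1 := by simp [hg, hh]
  simp only [altEval, dif_pos hg, dif_pos hh, dif_pos hgh]
  rw [← Module.End.mul_apply, ← map_mul]
  rfl

theorem altEval_injective {g : Perm α} (hg : sign g = 1) : Function.Injective (altEval ρ g) := by
  refine Function.LeftInverse.injective (g := altEval ρ g⁻¹) fun v => ?_
  rw [← altEval_mul ρ (by simp [hg]) hg, inv_mul_cancel, altEval_one]

theorem altEval_apply_comm {g h h' : Perm α} (hg : sign g = 1) (hh : sign h = 1)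
    (hh' : sign h' = 1) (e : g * h = h' * g) (v : V) :
    altEval ρ g (altEval ρ h v) = altEval ρ h' (altEval ρ g v) := by
  rw [← altEval_mul ρ hg hh, e, altEval_mul ρ hh' hg]

theorem altEval_inv_apply_eq {g : Perm α} (hg : sign g = 1) {v : V} (h : altEval ρ g v = v) :
    altEval ρ g⁻¹ v = v := by
  apply altEval_injective ρ hg
  rw [← altEval_mul ρ hg (by simp [hg]), mul_inv_cancel, altEval_one, h]

theorem altEval_cyc_cube {a b c : α} (h : [a, b, c].Nodup) (v : V) :
    altEval ρ (cyc a b c) (altEval ρ (cyc a b c) (altEval ρ (cyc a b c) v)) = v := by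
  have hs := sign_cyc h
  rw [← altEval_mul ρ hs hs, ← altEval_mul ρ (by simp [hs]) hs]
  convert altEval_one ρ v
  ext z
  simp only [cyc, Perm.mul_apply, swap_apply_def, Perm.one_apply]
  grind

theorem altEval_cyc_rev {a b c : α} (h : [a, b, c].Nodup) (v : V) :
    altEval ρ (cyc a c b) v = altEval ρ (cyc a b c) (altEval ρ (cyc a b c) v) := by
  have hs := sign_cyc h
  rw [← altEval_mul ρ hs hs]
  congr 2
  ext z
  simp only [cyc, Perm.mul_apply, swap_apply_def]
  grind

theorem isTetrahedral_altEval {a b c d : α} (h : [a, b, c, d].Nodup) :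
    IsTetrahedral (altEval ρ (dbl a b c d)) (altEval ρ (dbl b c a d))
      (altEval ρ (cyc a b c)) := by
  have hP : sign (dbl a b c d) = 1 := by simp at h; exact sign_dbl (by tauto) (by tauto)
  have hQ : sign (dbl b c a d) = 1 := by simp at h; exact sign_dbl (by tauto) (by tauto)
  have hX : sign (cyc a b c) = 1 := sign_cyc (by simp at h ⊢; tauto)
  constructor <;> intro v
  · rw [← altEval_mul ρ hP hP]
    convert altEval_one ρ v
    ext z
    simp only [dbl, Perm.mul_apply, swap_apply_def, Perm.one_apply]
    grind
  · rw [← altEval_mul ρ hQ hQ]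
    convert altEval_one ρ v
    ext z
    simp only [dbl, Perm.mul_apply, swap_apply_def, Perm.one_apply]
    grind
  · refine altEval_apply_comm ρ hP hQ hQ ?_ v
    ext z
    simp only [dbl, Perm.mul_apply, swap_apply_def]
    grind
  · exact altEval_cyc_cube ρ (by simp at h ⊢; tauto) v
  · refine altEval_apply_comm ρ hX hP hQ ?_ v
    ext z
    simp only [dbl, cyc, Perm.mul_apply, swap_apply_def]
    grind
  · rw [← altEval_mul ρ hP hQ]
    refine altEval_apply_comm ρ hX hQ (by simp [hP, hQ]) ?_ v
    ext z
    simp only [dbl, cyc, Perm.mul_apply, swap_apply_def]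
    grind

/-- If one double transposition acts nontrivially, then so do all of them. -/
theorem exists_dbl_apply_ne (hcard : 6 ≤ Fintype.card α) {a b c d a' b' c' d' : α}
    (h : [a, b, c, d].Nodup) (h' : [a', b', c', d'].Nodup)
    (hne : ∃ v, altEval ρ (dbl a b c d) v ≠ v) : ∃ v, altEval ρ (dbl a' b' c' d') v ≠ v := by
  obtain ⟨v, hv⟩ := hne
  obtain ⟨g, hg, hgl⟩ := exists_even_map_eq h h' rfl (by simpa using hcard)
  simp only [List.map_cons, List.map_nil, List.cons.injEq, and_true] at hgl
  obtain ⟨rfl, rfl, rfl, rfl⟩ := hgl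
  refine ⟨altEval ρ g v, fun h0 => hv (altEval_injective ρ hg ?_)⟩
  rw [← h0]
  have hs : ∀ {x y z t : α}, [x, y, z, t].Nodup → sign (dbl x y z t) = 1 := fun hn => by
    simp only [List.nodup_cons, List.mem_cons] at hn
    exact sign_dbl (by tauto) (by tauto)
  exact altEval_apply_comm ρ hg (hs h) (hs h') (conj_dbl ..) v

/-- A subspace stable under the even permutations supported on a subset of the letters carries a
representation of the alternating group on that subset. -/
theorem exists_restrict {p : α → Prop} [DecidablePred p] (W : Submodule k V)
    (hW : ∀ g : Perm {z // p z}, sign g = 1 → ∀ v ∈ W, altEval ρ (ofSubtype g) v ∈ W) :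
    ∃ ρ' : alternatingGroup {z // p z} →* End k W, ∀ g : Perm {z // p z}, sign g = 1 →
      ∀ v : W, (altEval ρ' g v : V) = altEval ρ (ofSubtype g) v := by
  have hs : ∀ g : alternatingGroup {z // p z}, sign (ofSubtype g.1) = 1 := fun g => by
    rw [sign_ofSubtype]; exact g.2
  refine ⟨{
    toFun g := (altEval ρ (ofSubtype g.1)).restrict (hW g.1 g.2)
    map_one' := ?_
    map_mul' g g' := ?_ }, fun g hg v => ?_⟩
  · ext v
    simp [altEval_one]
  · ext v
    simp [altEval_mul ρ (hs g) (hs g')]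
  · simp only [altEval, dif_pos hg]
    rfl

theorem dbl_apply_eq_of_mem_eigenspace {ω : k} {a b c d e f g : α} (h : [a, b, c, d, e, f, g].Nodup)
    (htriv : ∀ ρ' : alternatingGroup {z // z ∉ [a, b, c]} →*
        End k ((altEval ρ (cyc a b c)).eigenspace ω),
      ∀ d e f g, [d, e, f, g].Nodup → ∀ v, altEval ρ' (dbl d e f g) v = v)
    {v : V} (hv : altEval ρ (cyc a b c) v = ω • v) : altEval ρ (dbl d e f g) v = v := by
  have hc : sign (cyc a b c) = 1 := sign_cyc (by simp at h ⊢; tauto)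
  obtain ⟨ρ', hρ'⟩ := exists_restrict ρ (p := fun z => z ∉ [a, b, c])
    ((altEval ρ (cyc a b c)).eigenspace ω) (by
      intro g hg v hv
      rw [Module.End.mem_eigenspace_iff] at hv ⊢
      have hg' : sign (ofSubtype g) = 1 := by rw [sign_ofSubtype, hg]
      rw [altEval_apply_comm ρ hc hg' hg', hv, map_smul]
      have hfix : ∀ z ∈ [a, b, c], ofSubtype g z = z := fun z hz =>
        ofSubtype_apply_of_not_mem g (not_not.mpr hz)
      have := conj_cyc (ofSubtype g) a b c
      rw [hfix a (by simp), hfix b (by simp), hfix c (by simp)] at this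
      exact this.symm)
  have hd : d ∉ [a, b, c] := by simp at h ⊢; grind
  have he : e ∉ [a, b, c] := by simp at h ⊢; grind
  have hf : f ∉ [a, b, c] := by simp at h ⊢; grind
  have hg : g ∉ [a, b, c] := by simp at h ⊢; grind
  have hn : [(⟨d, hd⟩ : {z // z ∉ [a, b, c]}), ⟨e, he⟩, ⟨f, hf⟩, ⟨g, hg⟩].Nodup := by
    simp at h ⊢; tauto
  have h1 := htriv ρ' _ _ _ _ hn ⟨v, Module.End.mem_eigenspace_iff.mpr hv⟩
  have h2 := hρ' (dbl ⟨d, hd⟩ ⟨e, he⟩ ⟨f, hf⟩ ⟨g, hg⟩)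
    (sign_dbl (by simp at hn ⊢; tauto) (by simp at hn ⊢; tauto))
    ⟨v, Module.End.mem_eigenspace_iff.mpr hv⟩
  rw [h1] at h2
  simpa [dbl, ofSubtype_swap_eq] using h2.symm

end Evaluation

section PairVectors

variable {k V α : Type*} [Field k] [AddCommGroup V] [Module k V] [Fintype α] [DecidableEq α]
  (ρ : alternatingGroup α →* End k V)

theorem altEval_apply_eq_of_swap_mul_swap {a b c f : α} (h : [a, b, c, f].Nodup) {w : V}
    (hw : ∀ z, z ∉ [a, b, c, f] → altEval ρ (swap c f * swap c z) w = w)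
    {g : Perm α} (hg : sign g = 1) (hga : g a = a) (hgb : g b = b) : altEval ρ g w = w := by
  simp only [List.nodup_cons, List.mem_cons, List.not_mem_nil, or_false, not_or] at h hw
  have sign_pair : ∀ {x y : α}, x ≠ y → sign (swap c f * swap x y) = 1 := fun hxy => by
    simp [hxy, h.2.2.1]
  have fix_base : ∀ z, z ≠ a → z ≠ b → z ≠ c → altEval ρ (swap c f * swap c z) w = w := by
    intro z hza hzb hzc
    obtain rfl | hzf := eq_or_ne z f
    · rw [swap_mul_self, altEval_one]
    · exact hw z ⟨hza, hzb, hzc, hzf⟩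
  have fix_pair : ∀ x y, x ≠ y → x ≠ a → x ≠ b → y ≠ a → y ≠ b →
      altEval ρ (swap c f * swap x y) w = w := by
    intro x y hxy hxa hxb hya hyb
    obtain rfl | hxc := eq_or_ne x c
    · exact fix_base y hya hyb hxy.symm
    obtain rfl | hyc := eq_or_ne y c
    · rw [swap_comm x]
      exact fix_base x hxa hxb hxy
    have hx := sign_pair hxc.symm
    have hy := sign_pair hyc.symm
    have e : swap c f * swap x y =
        (swap c f * swap c x) * ((swap c f * swap c y)⁻¹ * (swap c f * swap c x)) := by
      have : swap x y = swap c x * (swap c y * swap c x) := by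
        ext z
        simp only [Perm.mul_apply, swap_apply_def]
        grind
      rw [this]
      simp [mul_assoc]
    rw [e, altEval_mul ρ hx (by rw [Perm.sign_mul, sign_inv, hx, hy, mul_one]),
      altEval_mul ρ (by rw [sign_inv, hy]) hx,
      fix_base x hxa hxb hxc, altEval_inv_apply_eq ρ hy (fix_base y hya hyb hyc),
      fix_base x hxa hxb hxc]
  have fix_subtype : ∀ σ : Perm {z // z ≠ a ∧ z ≠ b},
      (sign σ = 1 → altEval ρ (ofSubtype σ) w = w) ∧
      (sign σ = -1 → altEval ρ (swap c f * ofSubtype σ) w = w) := by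
    have hτ : sign (swap c f) = -1 := by simp [h.2.2.1]
    intro σ
    induction σ using swap_induction_on with
    | one => simp [altEval_one]
    | swap_mul σ x y hxy ih =>
      have hxy' : (x : α) ≠ y := fun e => hxy (Subtype.ext e)
      have hp := fix_pair x y hxy' x.2.1 x.2.2 y.2.1 y.2.2
      have hs := sign_pair hxy'
      simp only [map_mul, sign_swap hxy, ofSubtype_swap_eq, neg_one_mul, neg_inj]
      refine ⟨fun h1 => ?_, fun h1 => ?_⟩
      · have hσ : sign σ = -1 := by rw [← neg_eq_iff_eq_neg, h1]
        have e : swap (x : α) y * ofSubtype σ =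
            (swap c f * swap (x : α) y)⁻¹ * (swap c f * ofSubtype σ) := by
          simp [mul_assoc]
        rw [e, altEval_mul ρ (by rw [sign_inv, hs]) (by simp [hσ, hτ]), ih.2 hσ,
          altEval_inv_apply_eq ρ hs hp]
      · rw [← mul_assoc, altEval_mul ρ hs (by simp [h1]), ih.1 h1, hp]
  have hmem : ∀ z, (g z ≠ a ∧ g z ≠ b) ↔ (z ≠ a ∧ z ≠ b) := fun z => by
    rw [← g.injective.ne_iff (x := z) (y := a), ← g.injective.ne_iff (x := z) (y := b), hga, hgb]
  have hext : ofSubtype (g.subtypePerm hmem) = g :=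
    ofSubtype_subtypePerm (p := fun z => z ≠ a ∧ z ≠ b) hmem fun z hz => by
      refine ⟨?_, ?_⟩ <;> rintro rfl <;> contradiction
  rw [← hext]
  exact (fix_subtype _).1 (by rw [← sign_ofSubtype, hext, hg])

variable [CharZero k]

theorem card_le_finrank_add_one_of_pair_vectors [FiniteDimensional k V]
    (hcard : 5 ≤ Fintype.card α) (U : α → α → V) (hself : ∀ i, U i i = 0)
    (hne : ∀ i j, i ≠ j → U i j ≠ 0)
    (hanti : ∀ i j, U j i = -U i j) (hcocycle : ∀ i j l, U i j + U j l = U i l)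
    (hU : ∀ g : Perm α, sign g = 1 → ∀ i j, altEval ρ g (U i j) = U (g i) (g j)) :
    Fintype.card α ≤ finrank k V + 1 := by
  let Φ : (α → k) →ₗ[k] V := Fintype.linearCombination k fun i => ∑ j, U i j
  have hΦ : ∀ c, Φ c = ∑ i, c i • ∑ j, U i j := fun c => Fintype.linearCombination_apply ..
  have hdiff : ∀ i j, ∑ l, U i l - ∑ l, U j l = (Fintype.card α : k) • U i j := by
    intro i j
    rw [← Finset.sum_sub_distrib, Nat.cast_smul_eq_nsmul, ← Finset.card_univ, ← Finset.sum_const]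
    exact Finset.sum_congr rfl fun l _ => by rw [← hcocycle i j l, add_sub_cancel_right]
  have hcard0 : (Fintype.card α : k) ≠ 0 := by
    rw [Nat.cast_ne_zero]; omega
  have hker : ∀ c, Φ c = 0 → ∀ i j, c i = c j := by
    intro c hc i j
    by_cases hij : i = j
    · rw [hij]
    obtain ⟨l, hl⟩ := exists_notMem_list (l := [i, j]) (by simp; omega)
    obtain ⟨p, hp⟩ := exists_notMem_list (l := [i, j, l]) (by simp; omega)
    simp only [List.mem_cons, List.not_mem_nil, or_false, not_or] at hl hp
    have hg : sign (cyc i j l) = 1 := sign_cyc (by simp; tauto)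
    have g1 : cyc i j l i = j := by simp only [cyc, Perm.mul_apply, swap_apply_def]; grind
    have g2 : cyc i j l j = l := by simp only [cyc, Perm.mul_apply, swap_apply_def]; grind
    have g3 : cyc i j l l = i := by simp only [cyc, Perm.mul_apply, swap_apply_def]; grind
    have g4 : ∀ z, z ≠ i → z ≠ j → z ≠ l → cyc i j l z = z := by
      simp only [cyc, Perm.mul_apply, swap_apply_def]; grind
    have h1 : ∑ z, c z • U (cyc i j l z) z = 0 := by
      have h2 := congrArg (altEval ρ (cyc i j l)) hc
      rw [hΦ] at hc h2
      simp only [map_sum, map_smul, map_zero, hU _ hg] at h2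
      have h3 : (Fintype.card α : k) • ∑ z, c z • U (cyc i j l z) z = 0 := by
        rw [← sub_eq_zero.mpr (h2.trans hc.symm), Finset.smul_sum, ← Finset.sum_sub_distrib]
        refine Finset.sum_congr rfl fun z _ => ?_
        rw [Equiv.sum_comp (cyc i j l) (fun y => U (cyc i j l z) y), ← smul_sub, hdiff, smul_comm]
      exact (smul_eq_zero.mp h3).resolve_left hcard0
    have h2 : c i • U j i + c j • U l j + c l • U i l = 0 := by
      rw [← h1, ← Finset.sum_subset (Finset.subset_univ {i, j, l}),
        Finset.sum_insert (by simp; tauto), Finset.sum_insert (by simp; tauto),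
        Finset.sum_singleton, g1, g2, g3, add_assoc]
      intro z _ hz
      simp only [Finset.mem_insert, Finset.mem_singleton, not_or] at hz
      rw [g4 z hz.1 hz.2.1 hz.2.2, hself, smul_zero]
    obtain ⟨q, hq⟩ := exists_notMem_list (l := [i, j, l, p]) (by simp; omega)
    simp only [List.mem_cons, List.not_mem_nil, or_false, not_or] at hq
    have hr : sign (dbl i j p q) = 1 := sign_dbl hij (Ne.symm hq.2.2.2)
    have r1 : dbl i j p q i = j := by simp only [dbl, Perm.mul_apply, swap_apply_def]; grind
    have r2 : dbl i j p q j = i := by simp only [dbl, Perm.mul_apply, swap_apply_def]; grind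
    have r3 : dbl i j p q l = l := by simp only [dbl, Perm.mul_apply, swap_apply_def]; grind
    rw [hanti i j, hanti j l, ← hcocycle i j l] at h2
    have h3 := congrArg (altEval ρ (dbl i j p q)) h2
    simp only [map_add, map_smul, map_neg, map_zero, hU _ hr, r1, r2, r3] at h3
    rw [hanti i j, ← hcocycle i j l] at h3
    have h4 : (c l - c j) • (U i j + (2 : k) • U j l) = 0 := by
      linear_combination (norm := module) h2 + h3
    have h5 : U i j + (2 : k) • U j l ≠ 0 := fun h5 => by
      have h6 := congrArg (altEval ρ (cyc i j l)) h5
      simp only [map_add, map_smul, map_zero, hU _ hg, g1, g2, g3] at h6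
      rw [hanti i l, ← hcocycle i j l] at h6
      have h7 : (3 : k) • U j l = 0 := by
        linear_combination (norm := module) (2 : k) • h5 + h6
      exact hne j l (Ne.symm hl.2) (by simpa using h7)
    have h6 : c l - c j = 0 := (smul_eq_zero.mp h4).resolve_right h5
    have h7 : (c l - c i) • U i j = 0 := by
      linear_combination (norm := module) h2 - h6 • U j l
    have h8 : c l - c i = 0 := (smul_eq_zero.mp h7).resolve_right (hne i j hij)
    rw [← sub_eq_zero.mp h6, ← sub_eq_zero.mp h8]
  have hbound : finrank k (LinearMap.ker Φ) ≤ 1 := by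
    have : Nonempty α := Fintype.card_pos_iff.mp (by omega)
    obtain ⟨a⟩ := this
    have := LinearMap.finrank_le_finrank_of_injective
      (f := (LinearMap.proj a : (α → k) →ₗ[k] k) ∘ₗ (LinearMap.ker Φ).subtype) (by
        rw [injective_iff_map_eq_zero]
        rintro ⟨c, hc⟩ h0
        ext i
        exact (hker c hc i a).trans h0)
    simpa using this
  have h1 := LinearMap.finrank_range_add_finrank_ker Φ
  have h2 := Submodule.finrank_le (LinearMap.range Φ)
  rw [finrank_fintype_fun_eq_card] at h1
  omega

theorem card_le_finrank_add_one_of_negated_vector [FiniteDimensional k V]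
    (hcard : 5 ≤ Fintype.card α) {a b c f : α} (h : [a, b, c, f].Nodup) {w : V} (hw : w ≠ 0)
    (hfix : ∀ g : Perm α, sign g = 1 → g a = a → g b = b → altEval ρ g w = w)
    (hneg : altEval ρ (dbl a b c f) w = -w)
    (hsum : w + altEval ρ (cyc a b c) w + altEval ρ (cyc a b c) (altEval ρ (cyc a b c) w) = 0) :
    Fintype.card α ≤ finrank k V + 1 := by
  have hn := h
  simp only [List.nodup_cons, List.mem_cons, List.not_mem_nil, or_false, not_or] at hn
  have hab : a ≠ b := by tauto
  have exists_triple : ∀ i j l : α, i ≠ j → i ≠ l → j ≠ l →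
      ∃ g : Perm α, sign g = 1 ∧ g a = i ∧ g b = j ∧ g c = l := by
    intro i j l hij hil hjl
    obtain ⟨g, hg, hl⟩ := exists_even_map_eq (l := [a, b, c]) (l' := [i, j, l])
      (by simp; tauto) (by simp; tauto) rfl (by simpa using hcard)
    exact ⟨g, hg, by simpa using hl⟩
  have exists_pair : ∀ i j : α, i ≠ j → ∃ g : Perm α, sign g = 1 ∧ g a = i ∧ g b = j := by
    intro i j hij
    obtain ⟨l, hl⟩ := exists_notMem_list (l := [i, j]) (by simp; omega)
    simp only [List.mem_cons, List.not_mem_nil, or_false, not_or] at hl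
    obtain ⟨g, hg, h1, h2, -⟩ := exists_triple i j l hij (Ne.symm hl.1) (Ne.symm hl.2)
    exact ⟨g, hg, h1, h2⟩
  choose G hG using id exists_pair
  let U : α → α → V := fun i j => if hij : i ≠ j then altEval ρ (G i j hij) w else 0
  have hUself : ∀ i, U i i = 0 := fun i => by simp [U]
  have hUeq : ∀ g : Perm α, sign g = 1 → altEval ρ g w = U (g a) (g b) := by
    intro g hg
    have hij : g a ≠ g b := g.injective.ne hab
    obtain ⟨h1, h2, h3⟩ := hG _ _ hij
    simp only [U, dif_pos hij]
    have h4 : altEval ρ ((G _ _ hij)⁻¹ * g) w = w := by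
      apply hfix
      · rw [Perm.sign_mul, sign_inv, hg, h1, mul_one]
      · rw [Perm.mul_apply, inv_eq_iff_eq, h2]
      · rw [Perm.mul_apply, inv_eq_iff_eq, h3]
    conv_rhs => rw [← h4]
    rw [← altEval_mul ρ h1 (by rw [Perm.sign_mul, sign_inv, hg, h1, mul_one]),
      mul_inv_cancel_left]
  have hU : ∀ g : Perm α, sign g = 1 → ∀ i j, altEval ρ g (U i j) = U (g i) (g j) := by
    intro g hg i j
    obtain rfl | hij := eq_or_ne i j
    · rw [hUself, hUself, map_zero]
    · obtain ⟨g', h1, rfl, rfl⟩ := exists_pair i j hij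
      rw [← hUeq _ h1, ← altEval_mul ρ hg h1, hUeq _ (by rw [Perm.sign_mul, hg, h1, mul_one]),
        Perm.mul_apply, Perm.mul_apply]
  have hanti : ∀ i j, U j i = -U i j := by
    intro i j
    obtain rfl | hij := eq_or_ne i j
    · rw [hUself, neg_zero]
    · obtain ⟨g', h1, rfl, rfl⟩ := exists_pair i j hij
      have hr : sign (dbl a b c f) = 1 := sign_dbl hab (by tauto)
      have r1 : dbl a b c f a = b := by simp only [dbl, Perm.mul_apply, swap_apply_def]; grind
      have r2 : dbl a b c f b = a := by simp only [dbl, Perm.mul_apply, swap_apply_def]; grind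
      have h2 := hUeq (dbl a b c f) hr
      rw [hneg, r1, r2] at h2
      rw [← hU _ h1, ← h2, map_neg, hUeq _ h1]
  have hcocycle : ∀ i j l, U i j + U j l = U i l := by
    intro i j l
    obtain rfl | hij := eq_or_ne i j
    · rw [hUself, zero_add]
    obtain rfl | hjl := eq_or_ne j l
    · rw [hUself, add_zero]
    obtain rfl | hil := eq_or_ne i l
    · rw [hUself, hanti, neg_add_cancel]
    obtain ⟨g, hg, rfl, rfl, rfl⟩ := exists_triple i j l hij hil hjl
    have hx : sign (cyc a b c) = 1 := sign_cyc (by simp; tauto)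
    have g1 : cyc a b c a = b := by simp only [cyc, Perm.mul_apply, swap_apply_def]; grind
    have g2 : cyc a b c b = c := by simp only [cyc, Perm.mul_apply, swap_apply_def]; grind
    have g3 : cyc a b c c = a := by simp only [cyc, Perm.mul_apply, swap_apply_def]; grind
    have hw1 : w = U a b := by simpa [altEval_one] using hUeq 1 (by simp)
    rw [hw1, hU _ hx, hU _ hx, g1, g2, g3] at hsum
    have h1 := congrArg (altEval ρ g) hsum
    simp only [map_add, map_zero, hU _ hg] at h1
    rw [hanti (g a) (g c), ← sub_eq_add_neg, sub_eq_zero] at h1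
    exact h1
  refine card_le_finrank_add_one_of_pair_vectors ρ hcard U hUself (fun i j hij h0 => hw ?_)
    hanti hcocycle hU
  obtain ⟨g', h1, rfl, rfl⟩ := exists_pair i j hij
  rw [← hUeq _ h1] at h0
  exact altEval_injective ρ h1 (by rw [h0, map_zero])

end PairVectors

section LowerBound

variable {k V α : Type*} [Field k] [CharZero k] [AddCommGroup V] [Module k V]
  [FiniteDimensional k V] [Fintype α] [DecidableEq α] (ρ : alternatingGroup α →* End k V)

theorem card_le_finrank_add_one_of_fixes (hcard : 5 ≤ Fintype.card α) {a b c f : α}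
    (h : [a, b, c, f].Nodup) (hne : ∃ v, altEval ρ (dbl a b c f) v ≠ v)
    (hfix : ∀ z ∉ [a, b, c, f], ∀ w,
      w + altEval ρ (cyc a b c) w + altEval ρ (cyc a b c) (altEval ρ (cyc a b c) w) = 0 →
      w + altEval ρ (cyc b a f) w + altEval ρ (cyc b a f) (altEval ρ (cyc b a f) w) = 0 →
      altEval ρ (swap c f * swap c z) w = w) :
    Fintype.card α ≤ finrank k V + 1 := by
  obtain ⟨v, hv⟩ := hne
  obtain ⟨w, hw, hP, hX⟩ := (isTetrahedral_altEval ρ h).exists_negated_vector hv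
  have hn := h
  simp only [List.nodup_cons, List.mem_cons, List.not_mem_nil, or_false, not_or] at hn
  have hd : sign (dbl a b c f) = 1 := sign_dbl (by tauto) (by tauto)
  have hc : sign (cyc a b c) = 1 := sign_cyc (by simp; tauto)
  have hc' : sign (cyc b a f) = 1 := sign_cyc (by simp; grind)
  have hcomm := altEval_apply_comm ρ hd hc hc' (by
    rw [conj_cyc]
    congr 2 <;> simp only [dbl, Perm.mul_apply, swap_apply_def] <;> grind)
  have hX' : w + altEval ρ (cyc b a f) w + altEval ρ (cyc b a f) (altEval ρ (cyc b a f) w) = 0 := by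
    have h1 := congrArg (altEval ρ (dbl a b c f)) hX
    simp only [map_add, map_zero, hcomm, hP, map_neg] at h1
    linear_combination (norm := module) -h1
  exact card_le_finrank_add_one_of_negated_vector ρ hcard h hw
    (fun g hg hga hgb => altEval_apply_eq_of_swap_mul_swap ρ h
      (fun z hz => hfix z hz w hX hX') hg hga hgb) hP hX

variable {ω : k}

theorem two_mul_finrank_eigenspace_cyc_lt (hω : ω ^ 2 + ω + 1 = 0) (hcard : 5 ≤ Fintype.card α)
    (hact : ∀ a b c d : α, [a, b, c, d].Nodup → ∃ v, altEval ρ (dbl a b c d) v ≠ v)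
    {a b c : α} (h : [a, b, c].Nodup) :
    2 * finrank k ((altEval ρ (cyc a b c)).eigenspace ω) < finrank k V := by
  obtain ⟨d, hd⟩ := exists_notMem_list (l := [a, b, c]) (by simp; omega)
  obtain ⟨e, he⟩ := exists_notMem_list (l := [a, b, c, d]) (by simp; omega)
  have hc := sign_cyc h
  have hr : sign (cyc a c b) = 1 := sign_cyc (by simp at h ⊢; grind)
  simp only [List.nodup_cons, List.mem_cons, List.not_mem_nil, or_false, not_or] at h hd he
  have hdbl : sign (dbl a b d e) = 1 := sign_dbl (by tauto) (by grind)
  have h4 : [a, b, c, d].Nodup := by simp; grind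
  obtain ⟨v, hv⟩ := hact a b c d h4
  obtain ⟨t, ht, hXt⟩ := (isTetrahedral_altEval ρ h4).exists_fixed_vector hv
  refine two_mul_finrank_eigenspace_lt hω (altEval_injective ρ hdbl) (fun v => ?_) ht hXt
  rw [← altEval_cyc_rev ρ (by simp; grind)]
  refine (altEval_apply_comm ρ hdbl hr hc ?_ v).symm
  rw [← cyc_rotate (show [a, b, c].Nodup by simp; grind)]
  refine conj_cyc_eq ?_ ?_ ?_ <;> simp only [dbl, Perm.mul_apply, swap_apply_def] <;> grind

theorem card_le_finrank_add_one_of_dbl_fixes_eigenspace (hω : ω ^ 2 + ω + 1 = 0)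
    (hcard : 7 ≤ Fintype.card α) {a b c f : α}
    (h : [a, b, c, f].Nodup) (hne : ∃ v, altEval ρ (dbl a b c f) v ≠ v)
    (hfix : ∀ a b c d e f g : α, [a, b, c, d, e, f, g].Nodup →
      ∀ v, altEval ρ (cyc a b c) v = ω • v → altEval ρ (dbl d e f g) v = v) :
    Fintype.card α ≤ finrank k V + 1 := by
  have hω3 : ω ^ 3 = 1 := by linear_combination (ω - 1) * hω
  have hfix' : ∀ a b c d e f g : α, [a, b, c, d, e, f, g].Nodup → ∀ w,
      w + altEval ρ (cyc a b c) w + altEval ρ (cyc a b c) (altEval ρ (cyc a b c) w) = 0 →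
      altEval ρ (dbl d e f g) w = w := by
    intro a b c d e f g h w hw
    refine fixes_of_fixes_eigenspaces hω (hfix a b c d e f g h) (fun v hv => ?_) hw
    refine hfix a c b d e f g (by simp at h ⊢; grind) v ?_
    rw [altEval_cyc_rev ρ (by simp at h ⊢; tauto), hv, map_smul, hv]
    linear_combination (norm := module) (ω * hω3) • v
  refine card_le_finrank_add_one_of_fixes ρ (by omega) h hne fun z hz w hX hX' => ?_
  obtain ⟨u, hu⟩ := exists_notMem_list (l := [a, b, c, f, z]) (by simp; omega)
  obtain ⟨y, hy⟩ := exists_notMem_list (l := [a, b, c, f, z, u]) (by simp; omega)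
  simp only [List.nodup_cons, List.mem_cons, List.not_mem_nil, or_false, not_or] at h hz hu hy
  have h1 := hfix' a b c u y f z (by simp; grind) w hX
  have h2 := hfix' b a f u y c z (by simp; grind) w hX'
  have e : swap c f * swap c z = dbl u y c z * dbl u y f z := by
    ext x
    simp only [dbl, Perm.mul_apply, swap_apply_def]
    grind
  rw [e, altEval_mul ρ (sign_dbl (by grind) (by grind)) (sign_dbl (by grind) (by grind)), h1, h2]

theorem card_le_finrank_add_one_of_card_eq_six (hω : ω ^ 2 + ω + 1 = 0)
    (hcard : Fintype.card α = 6) {a b c f : α}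
    (h : [a, b, c, f].Nodup) (hne : ∃ v, altEval ρ (dbl a b c f) v ≠ v)
    (hdim : ∀ a b c : α, [a, b, c].Nodup →
      finrank k ((altEval ρ (cyc a b c)).eigenspace ω) ≤ 1) :
    Fintype.card α ≤ finrank k V + 1 := by
  have hω3 : ω ^ 3 = 1 := by linear_combination (ω - 1) * hω
  have hscalar : ∀ a b c, [a, b, c].Nodup → ∀ v u, v ≠ 0 → altEval ρ (cyc a b c) v = ω • v →
      altEval ρ (cyc a b c) u = ω • u → ∃ r : k, r • v = u := by
    intro a b c h v u hv0 hv hu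
    obtain ⟨t, ht⟩ := finrank_le_one_iff.mp (hdim a b c h)
    obtain ⟨r, hr⟩ := ht ⟨v, Module.End.mem_eigenspace_iff.mpr hv⟩
    obtain ⟨s, hs⟩ := ht ⟨u, Module.End.mem_eigenspace_iff.mpr hu⟩
    simp only [Subtype.ext_iff, Submodule.coe_smul] at hr hs
    have hr0 : r ≠ 0 := by rintro rfl; exact hv0 (by rw [← hr, zero_smul])
    exact ⟨s * r⁻¹, by rw [← hs, ← hr, smul_smul, inv_mul_cancel_right₀ hr0]⟩
  have hnot : ∀ a b c d e f : α, [a, b, c, d, e, f].Nodup → ∀ v, v ≠ 0 →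
      altEval ρ (cyc a b c) v = ω • v → altEval ρ (cyc d e f) v ≠ ω • v := by
    intro a b c d e f h v hv0 hy hx
    have hn1 : [a, b, c].Nodup := by simp at h ⊢; tauto
    have hn2 : [d, e, f].Nodup := by simp at h ⊢; tauto
    have hn3 : [a, c, b].Nodup := by simp at h ⊢; grind
    obtain ⟨g, hg, g1, g2, g3, g4, g5, g6⟩ : ∃ g : Perm α, sign g = 1 ∧
        g a = d ∧ g b = e ∧ g c = f ∧ g d = a ∧ g e = c ∧ g f = b := by
      simp only [List.nodup_cons, List.mem_cons, List.not_mem_nil, or_false, not_or] at h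
      refine ⟨swap a d * swap b e * (swap e c * swap c f), ?_, ?_, ?_, ?_, ?_, ?_, ?_⟩
      · have : e ≠ c := by grind
        simp [h, this]
      all_goals
        simp only [Perm.mul_apply, swap_apply_def]
        grind
    have hxg := altEval_apply_comm ρ hg (sign_cyc hn1) (sign_cyc hn2) (conj_cyc_eq g1 g2 g3) v
    have hyg := altEval_apply_comm ρ hg (sign_cyc hn2) (sign_cyc hn3) (conj_cyc_eq g4 g5 g6) v
    rw [hy, map_smul] at hxg
    rw [hx, map_smul] at hyg
    obtain ⟨r, hr⟩ := hscalar d e f hn2 v (altEval ρ g v) hv0 hx hxg.symm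
    have hr0 : r ≠ 0 := by
      rintro rfl
      rw [zero_smul] at hr
      exact hv0 (altEval_injective ρ hg (by rw [← hr, map_zero]))
    rw [← hr, altEval_cyc_rev ρ hn1, map_smul, map_smul, hy, map_smul, hy] at hyg
    have h1 : (r * (ω - ω ^ 2)) • v = 0 := by linear_combination (norm := module) hyg
    have h2 := (mul_eq_zero.mp ((smul_eq_zero.mp h1).resolve_right hv0)).resolve_left hr0
    have h3 : (3 : k) = 0 := by linear_combination (3 - 2 * ω) * hω - (2 * ω + 1) * h2
    exact three_ne_zero h3
  have hfix : ∀ a b c d e f : α, [a, b, c, d, e, f].Nodup → ∀ v,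
      altEval ρ (cyc a b c) v = ω • v → altEval ρ (cyc d e f) v = v := by
    intro a b c d e f h v hy
    obtain rfl | hv0 := eq_or_ne v 0
    · rw [map_zero]
    have hn1 : [a, b, c].Nodup := by simp at h ⊢; tauto
    have hn2 : [d, e, f].Nodup := by simp at h ⊢; tauto
    have hs1 := sign_cyc hn1
    have hs2 := sign_cyc hn2
    obtain ⟨r, hr⟩ := hscalar a b c hn1 v (altEval ρ (cyc d e f) v) hv0 hy (by
      rw [altEval_apply_comm ρ hs1 hs2 hs2 ?_, hy, map_smul]
      refine conj_cyc_eq ?_ ?_ ?_ <;> simp only [cyc, Perm.mul_apply, swap_apply_def] <;> grind)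
    have h1 := altEval_cyc_cube ρ hn2 v
    simp only [← hr, map_smul] at h1
    have h2 : (r ^ 3 - 1) • v = 0 := by linear_combination (norm := module) h1
    have h3 : r ^ 3 - 1 = 0 := (smul_eq_zero.mp h2).resolve_right hv0
    have h4 : r - ω ≠ 0 := fun h4 => hnot a b c d e f h v hv0 hy (by
      rw [← hr, sub_eq_zero.mp h4])
    have h5 : r - ω ^ 2 ≠ 0 := fun h5 => hnot a b c d f e (by simp at h ⊢; grind) v hv0 hy (by
      rw [altEval_cyc_rev ρ hn2, ← hr, map_smul, ← hr, sub_eq_zero.mp h5]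
      linear_combination (norm := module) (ω * hω3) • v)
    have h6 : (r - 1) * ((r - ω) * (r - ω ^ 2)) = 0 := by
      linear_combination h3 + (r - r ^ 2) * hω + (r - 1) * hω3
    have h7 := (mul_eq_zero.mp h6).resolve_right (mul_ne_zero h4 h5)
    rw [← hr, sub_eq_zero.mp h7, one_smul]
  have hfix' : ∀ a b c d e f : α, [a, b, c, d, e, f].Nodup → ∀ w,
      w + altEval ρ (cyc a b c) w + altEval ρ (cyc a b c) (altEval ρ (cyc a b c) w) = 0 →
      altEval ρ (cyc d e f) w = w := by
    intro a b c d e f h w hw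
    refine fixes_of_fixes_eigenspaces hω (hfix a b c d e f h) (fun v hv => ?_) hw
    refine hfix a c b d e f (by simp at h ⊢; grind) v ?_
    rw [altEval_cyc_rev ρ (by simp at h ⊢; tauto), hv, map_smul, hv]
    linear_combination (norm := module) (ω * hω3) • v
  refine card_le_finrank_add_one_of_fixes ρ (by omega) h hne fun z hz w hX hX' => ?_
  obtain ⟨u, hu⟩ := exists_notMem_list (l := [a, b, c, f, z]) (by simp; omega)
  simp only [List.nodup_cons, List.mem_cons, List.not_mem_nil, or_false, not_or] at h hz hu
  have h1 := hfix' a b c f u z (by simp; grind) w hX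
  have h1' := hfix' a b c f z u (by simp; grind) w hX
  have h2 := hfix' b a f c u z (by simp; grind) w hX'
  have e : swap c f * swap c z = cyc f u z * (cyc c u z * cyc f z u) := by
    ext x
    simp only [cyc, Perm.mul_apply, swap_apply_def]
    grind
  have hs : sign (cyc c u z) = 1 := sign_cyc (by simp; grind)
  have hs1 : sign (cyc f u z) = 1 := sign_cyc (by simp; grind)
  have hs2 : sign (cyc f z u) = 1 := sign_cyc (by simp; grind)
  rw [e, altEval_mul ρ hs1 (by rw [Perm.sign_mul, hs, hs2, mul_one]), altEval_mul ρ hs hs2,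
    h1', h2, h1]

end LowerBound

theorem finrank_lower_bound {k : Type*} [Field k] [CharZero k] {ω : k} (hω : ω ^ 2 + ω + 1 = 0)
    (N : ℕ) {V : Type*} {α : Type*} [AddCommGroup V] [Module k V] [FiniteDimensional k V]
    [Fintype α] [DecidableEq α] (ρ : alternatingGroup α →* End k V)
    (hN : Fintype.card α = N) (hN4 : 4 ≤ N) {a b c d : α} (h : [a, b, c, d].Nodup)
    (hne : ∃ v, altEval ρ (dbl a b c d) v ≠ v) :
    (N ≠ 5 → N ≤ finrank k V + 1) ∧ (N = 5 → 3 ≤ finrank k V) := by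
  induction N using Nat.strong_induction_on generalizing V α with
  | _ N ih =>
  obtain ⟨v, hv⟩ := id hne
  have h3 := (isTetrahedral_altEval ρ h).three_le_finrank hv
  refine ⟨fun hN5 => ?_, fun _ => h3⟩
  obtain rfl | hN6 : N = 4 ∨ 6 ≤ N := by omega
  · omega
  by_contra! hlt
  have hdim : ∀ a b c : α, [a, b, c].Nodup →
      2 * finrank k ((altEval ρ (cyc a b c)).eigenspace ω) < finrank k V := fun a b c h' =>
    two_mul_finrank_eigenspace_cyc_lt ρ hω (by omega)
      (fun p q r s h' => exists_dbl_apply_ne ρ (by omega) h h' hne) h'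
  obtain rfl | hN7 : N = 6 ∨ 7 ≤ N := by omega
  · have := card_le_finrank_add_one_of_card_eq_six ρ hω hN h hne fun a b c h' => by
      have := hdim a b c h'
      omega
    omega
  · have := card_le_finrank_add_one_of_dbl_fixes_eigenspace ρ hω (by omega) h hne
      fun p q r d e f g h' v hv => dbl_apply_eq_of_mem_eigenspace ρ h'
        (fun ρ' d e f g hn => by
          by_contra! hne'
          have hpqr : [p, q, r].Nodup := by simp at h' ⊢; tauto
          have hcard : Fintype.card {z // z ∉ [p, q, r]} = N - 3 := by
            rw [Fintype.card_subtype_compl, hN,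
              Fintype.card_of_subtype [p, q, r].toFinset (by simp), List.toFinset_card_of_nodup hpqr]
            rfl
          have h1 := ih (N - 3) (by omega) ρ' hcard (by omega) hn hne'
          have h2 := hdim p q r hpqr
          omega) hv
    omega

/-- **Minimal degrees of faithful irreducible representations of alternating groups in
characteristic 0 (I. Schur).** If `m ≥ 4` and `φ : Alt_m → GL_n(k)` is a faithful
irreducible representation over a field of characteristic 0, then `n ≥ m − 1` when
`m ≠ 5`, and `n ≥ 3` when `m = 5`. -/
theorem stmt3 {k : Type*} [Field k] [CharZero k] {m n : ℕ} (hm : 4 ≤ m)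
    (φ : alternatingGroup (Fin m) →* Matrix.GeneralLinearGroup (Fin n) k)
    (hinj : Function.Injective φ) (hirr : IrreducibleRep φ) :
    (m ≠ 5 → m - 1 ≤ n) ∧ (m = 5 → 3 ≤ n) := by
  classical
  let K := AlgebraicClosure k
  obtain ⟨ω, hω⟩ : ∃ ω : K, ω ^ 2 + ω + 1 = 0 := by
    obtain ⟨ω, hω⟩ := IsAlgClosed.exists_root (Polynomial.X ^ 2 + Polynomial.X + 1 : Polynomial K)
      (by
        have : (Polynomial.X ^ 2 + Polynomial.X + 1 : Polynomial K).degree = 2 := by compute_degree!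
        rw [this]
        decide)
    exact ⟨ω, by simpa using hω⟩
  let ψ : alternatingGroup (Fin m) →* Matrix (Fin n) (Fin n) K :=
    ((algebraMap k K).mapMatrix.toMonoidHom.comp (Units.coeHom _)).comp φ
  let ρ : alternatingGroup (Fin m) →* End K (Fin n → K) :=
    (Matrix.toLinAlgEquiv' (R := K) (n := Fin n)).toAlgHom.toRingHom.toMonoidHom.comp ψ
  have hρ : Function.Injective ρ :=
    (Matrix.toLinAlgEquiv' (R := K) (n := Fin n)).injective.comp
      ((Matrix.map_injective (algebraMap k K).injective).comp (Units.val_injective.comp hinj))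
  let i : Fin 4 → Fin m := Fin.castLE hm
  have hi : Function.Injective i := Fin.castLE_injective hm
  have h : [i 0, i 1, i 2, i 3].Nodup := by simp [hi.eq_iff]
  have hs : sign (dbl (i 0) (i 1) (i 2) (i 3)) = 1 :=
    sign_dbl (by simp [hi.eq_iff]) (by simp [hi.eq_iff])
  have hne : ∃ v, altEval ρ (dbl (i 0) (i 1) (i 2) (i 3)) v ≠ v := by
    by_contra! hc
    have h1 : ρ ⟨dbl (i 0) (i 1) (i 2) (i 3), mem_alternatingGroup.mpr hs⟩ = ρ 1 := by
      rw [← altEval_coe, map_one]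
      exact LinearMap.ext hc
    have h2 := congrArg (fun g : alternatingGroup (Fin m) => (g : Perm (Fin m)) (i 0)) (hρ h1)
    simp [dbl, swap_apply_def, hi.eq_iff] at h2
  have hfin := finrank_lower_bound hω m ρ (Fintype.card_fin m) hm h hne
  rw [finrank_fin_fun] at hfin
  exact ⟨fun h5 => by have := hfin.1 h5; omega, hfin.2⟩
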